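/- Fix t₀ ∈ ℝ and a Banach space X. Let ψ₁, ψ₂ ∈ K∞ and V : X → [0,∞) be continuous with ψ₁(‖x‖) ≤ V(x) ≤ ψ₂(‖x‖) for all x ∈ X. Let φ and α be positive definite, χ ∈ K∞, and θ > 0 satisfy ∫_a^{α(a)} ds/φ(s) ≤ θ for every a > 0. Then there exist ξ ∈ K∞ and γ of class K, independent of the impulse time sequence, such that for every impulse time sequence T ∈ S_θ, every u ≥ 0 and every x : [t₀,∞) → X for which y := V∘x is a (T,u)-Lyapunov trajectory for (ω, α, χ) with ω(s) = −φ(s), one has ‖x(t)‖ ≤ ξ(‖x(t₀)‖) + γ(u) for all t ≥ t₀ (uniform global stability over S_θ). -/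

import Mathlib

open Set Filter Topology intervalIntegral

/-- A class `K` function: continuous, strictly increasing on `[0,∞)` with `γ(0) = 0`. -/
def ClassK (γ : ℝ → ℝ) : Prop :=
  ContinuousOn γ (Set.Ici 0) ∧ StrictMonoOn γ (Set.Ici 0) ∧ γ 0 = 0

/-- A class `K∞` function: class `K` and unbounded. -/
def ClassKinf (γ : ℝ → ℝ) : Prop :=
  ClassK γ ∧ Filter.Tendsto γ Filter.atTop Filter.atTop

/-- A positive definite function. -/
def PosDef (φ : ℝ → ℝ) : Prop :=
  ContinuousOn φ (Set.Ici 0) ∧ φ 0 = 0 ∧ ∀ s > (0:ℝ), 0 < φ s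

/-- A class `L` function. -/
def ClassL (g : ℝ → ℝ) : Prop :=
  ContinuousOn g (Set.Ici 0) ∧ StrictAntiOn g (Set.Ici 0) ∧
    Filter.Tendsto g Filter.atTop (nhds 0)

/-- A class `KL` function. -/
def ClassKL (β : ℝ → ℝ → ℝ) : Prop :=
  ContinuousOn (fun p : ℝ × ℝ => β p.1 p.2) (Set.Ici 0 ×ˢ Set.Ici 0) ∧
  (∀ t ≥ (0:ℝ), ClassK fun r => β r t) ∧
  (∀ r > (0:ℝ), ClassL fun t => β r t)

/-- An impulse time sequence: strictly increasing, starting after `t0` and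
tending to infinity (no finite accumulation points). -/
def ImpulseSeq (t0 : ℝ) (T : ℕ → ℝ) : Prop :=
  StrictMono T ∧ t0 < T 0 ∧ Filter.Tendsto T Filter.atTop Filter.atTop

/-- `y : [t0,∞) → [0,∞)` is a `(T,u)`-Lyapunov trajectory for `(ω, α, χ)`, with
left limits `ym i` at the impulse times `T i`: it is piecewise continuous
(right-continuous at impulse times), differentiable off `T` with
`y' ≤ ω(y)` whenever `y ≥ χ(u)`, and satisfies the jump estimate
`y(T i) ≤ max (α (ym i)) (χ u)`. -/
def LyapTraj (t0 : ℝ) (T : ℕ → ℝ) (u : ℝ) (ω α χ : ℝ → ℝ)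
    (y : ℝ → ℝ) (ym : ℕ → ℝ) : Prop :=
  (∀ t ≥ t0, 0 ≤ y t) ∧
  ContinuousOn y (Set.Ico t0 (T 0)) ∧
  (∀ i, ContinuousOn y (Set.Ico (T i) (T (i+1)))) ∧
  (∀ i, Filter.Tendsto y (nhdsWithin (T i) (Set.Iio (T i))) (nhds (ym i))) ∧
  (∀ t ≥ t0, (∀ i, t ≠ T i) → DifferentiableAt ℝ y t) ∧
  (∀ t ≥ t0, (∀ i, t ≠ T i) → χ u ≤ y t → deriv y t ≤ ω (y t)) ∧
  (∀ i, y (T i) ≤ max (α (ym i)) (χ u))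

/-! ### Comparison functions -/

lemma ClassK.nonneg {γ : ℝ → ℝ} (h : ClassK γ) {r : ℝ} (hr : 0 ≤ r) : 0 ≤ γ r := by
  have := h.2.1.monotoneOn self_mem_Ici hr hr
  rwa [h.2.2] at this

lemma ClassK.comp {γ η : ℝ → ℝ} (hγ : ClassK γ) (hη : ClassK η) : ClassK (γ ∘ η) :=
  have hmaps : MapsTo η (Ici 0) (Ici 0) := fun _ hr => hη.nonneg hr
  ⟨hγ.1.comp hη.1 hmaps, hγ.2.1.comp hη.2.1 hmaps, by simp [hη.2.2, hγ.2.2]⟩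

lemma ClassKinf.comp {γ η : ℝ → ℝ} (hγ : ClassKinf γ) (hη : ClassKinf η) :
    ClassKinf (γ ∘ η) :=
  ⟨hγ.1.comp hη.1, hγ.2.comp hη.2⟩

/-- A class `K∞` function has a left inverse on `[0,∞)` that is again of class `K∞`. -/
lemma ClassKinf.exists_leftInverse {ψ : ℝ → ℝ} (h : ClassKinf ψ) :
    ∃ g : ℝ → ℝ, ClassKinf g ∧ ∀ r ≥ (0 : ℝ), g (ψ r) = r := by
  obtain ⟨⟨hc, hm, h0⟩, ht⟩ := h
  set Ψ : ℝ → ℝ := fun r => ψ (max r 0) + min r 0 with hΨ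
  have hΨ_pos : ∀ r ≥ (0 : ℝ), Ψ r = ψ r := fun r hr => by
    simp [hΨ, max_eq_left hr, min_eq_right hr]
  have hΨ_neg : ∀ r ≤ (0 : ℝ), Ψ r = r := fun r hr => by
    simp [hΨ, max_eq_right hr, min_eq_left hr, h0]
  have hΨc : Continuous Ψ :=
    (hc.comp_continuous (by fun_prop) fun r => le_max_right r 0).add (by fun_prop)
  have hΨm : StrictMono Ψ := by
    intro a b hab
    have hmono : ψ (max a 0) ≤ ψ (max b 0) :=
      hm.monotoneOn (le_max_right a 0) (le_max_right b 0) (max_le_max_right 0 hab.le)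
    rcases le_or_gt 0 a with ha | ha
    · rw [hΨ_pos a ha, hΨ_pos b (ha.trans hab.le)]
      exact hm ha (ha.trans hab.le) hab
    · have : min a 0 < min b 0 := by
        rw [min_eq_left ha.le]
        exact lt_min hab ha
      exact add_lt_add_of_le_of_lt hmono this
  have htop : Tendsto Ψ atTop atTop :=
    ht.congr' ((eventually_ge_atTop 0).mono fun r hr => (hΨ_pos r hr).symm)
  have hbot : Tendsto Ψ atBot atBot :=
    tendsto_id.congr' ((eventually_le_atBot 0).mono fun r hr => (hΨ_neg r hr).symm)
  let e : ℝ ≃o ℝ := hΨm.orderIsoOfSurjective Ψ (hΨc.surjective htop hbot)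
  have he : ∀ r, e.symm (Ψ r) = r := fun r => e.symm_apply_apply r
  refine ⟨e.symm, ⟨⟨e.symm.continuous.continuousOn, e.symm.strictMono.strictMonoOn _, ?_⟩,
    e.symm.tendsto_atTop⟩, fun r hr => ?_⟩
  · simpa [hΨ_neg 0 le_rfl] using he 0
  · rw [← hΨ_pos r hr, he]

/-- A positive definite function is dominated on `[0,r]` by the value at `r` of a class `K∞`
function, which can also be taken above the identity. -/
lemma PosDef.exists_classKinf_majorant {α : ℝ → ℝ} (h : PosDef α) :
    ∃ A : ℝ → ℝ, ClassKinf A ∧ (∀ r ≥ (0 : ℝ), r ≤ A r) ∧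
      ∀ r, ∀ s ∈ Icc 0 r, α s ≤ A r := by
  obtain ⟨hc, h0, hpos⟩ := h
  have hnn : ∀ s ≥ (0 : ℝ), 0 ≤ α s := fun s hs => by
    rcases hs.eq_or_lt with rfl | hs
    · exact h0.ge
    · exact (hpos s hs).le
  set f : ℝ → ℝ → ℝ := fun r s => α |s * r| with hf
  have hfc : Continuous ↿f :=
    hc.comp_continuous (f := fun p : ℝ × ℝ => |p.2 * p.1|) (by fun_prop)
      fun p => mem_Ici.2 (abs_nonneg _)
  set S : ℝ → ℝ := fun r => sSup (f r '' Icc 0 1) with hS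
  have hSc : Continuous S := isCompact_Icc.continuous_sSup hfc
  have hbdd : ∀ r, BddAbove (f r '' Icc 0 1) := fun r =>
    (isCompact_Icc.image (hfc.comp (Continuous.prodMk_right r))).bddAbove
  have hle : ∀ r, ∀ s ∈ Icc 0 r, α s ≤ S r := by
    rintro r s ⟨hs, hsr⟩
    refine le_csSup (hbdd r) ⟨s / r, ⟨div_nonneg hs (hs.trans hsr),
      div_le_one_of_le₀ hsr (hs.trans hsr)⟩, ?_⟩
    rcases (hs.trans hsr).eq_or_lt with hr | hr
    · have : s = 0 := le_antisymm (hsr.trans hr.ge) hs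
      simp [hf, ← hr, this]
    · simp only [hf, div_mul_cancel₀ s hr.ne', abs_of_nonneg hs]
  have hSnn : ∀ r ≥ (0 : ℝ), 0 ≤ S r := fun r hr => (hnn r hr).trans (hle r r ⟨hr, le_rfl⟩)
  have hSm : MonotoneOn S (Ici 0) := by
    intro a ha b hb hab
    refine csSup_le ((nonempty_Icc.2 zero_le_one).image _) ?_
    rintro _ ⟨s, ⟨hs0, hs1⟩, rfl⟩
    refine hle b _ ⟨abs_nonneg _, ?_⟩
    rw [abs_of_nonneg (mul_nonneg hs0 ha)]
    exact (mul_le_of_le_one_left ha hs1).trans hab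
  have hS0 : S 0 = 0 := by
    have : f 0 '' Icc 0 1 = {0} := by
      simp [hf, h0, (nonempty_Icc.2 (zero_le_one (α := ℝ))).image_const]
    simp [hS, this]
  refine ⟨fun r => r + S r, ⟨⟨(continuous_id.add hSc).continuousOn, ?_, by simp [hS0]⟩, ?_⟩,
    fun r hr => le_add_of_nonneg_right (hSnn r hr),
    fun r s hs => (hle r s hs).trans (le_add_of_nonneg_left (hs.1.trans hs.2))⟩
  · exact fun a ha b hb hab => add_lt_add_of_lt_of_le hab (hSm ha hb hab.le)
  · exact tendsto_atTop_mono' _ ((eventually_ge_atTop 0).mono fun r hr =>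
      le_add_of_nonneg_right (hSnn r hr)) tendsto_id

/-! ### Flow estimates between two impulses -/

/-- If `y` does not increase while above `M`, it stays below `M` once it is there. -/
lemma le_of_deriv_nonpos_of_lt {y : ℝ → ℝ} {s e M : ℝ} (hc : ContinuousOn y (Ico s e))
    (hd : ∀ t ∈ Ioo s e, M < y t → deriv y t ≤ 0)
    (hdiff : ∀ t ∈ Ioo s e, DifferentiableAt ℝ y t) {r t : ℝ} (hr : s ≤ r) (hrt : r ≤ t)
    (hte : t < e) (hM : y r ≤ M) : y t ≤ M := by
  by_contra! hlt
  have hsub : Icc r t ⊆ Ico s e := fun q hq => ⟨hr.trans hq.1, hq.2.trans_lt hte⟩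
  have hcl : IsClosed (Icc r t ∩ y ⁻¹' Iic M) :=
    (hc.mono hsub).preimage_isClosed_of_isClosed isClosed_Icc isClosed_Iic
  have hcomp : IsCompact (Icc r t ∩ y ⁻¹' Iic M) :=
    isCompact_Icc.of_isClosed_subset hcl inter_subset_left
  obtain ⟨q, ⟨⟨hrq, hqt⟩, hqM⟩, hmax⟩ :=
    hcomp.exists_isGreatest ⟨r, ⟨le_rfl, hrt⟩, hM⟩
  have habove : ∀ p ∈ Ioo q t, M < y p := fun p hp => by
    by_contra! hp'
    exact (hmax ⟨⟨hrq.trans hp.1.le, hp.2.le⟩, hp'⟩).not_gt hp.1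
  have hIoo : Ioo q t ⊆ Ioo s e := Ioo_subset_Ioo (hr.trans hrq) hte.le
  have hanti : AntitoneOn y (Icc q t) := by
    refine antitoneOn_of_deriv_nonpos (convex_Icc q t)
      (hc.mono ((Icc_subset_Icc_left hrq).trans hsub)) ?_ ?_ <;> rw [interior_Icc]
    · exact fun p hp => (hdiff p (hIoo hp)).differentiableWithinAt
    · exact fun p hp => hd p (hIoo hp) (habove p hp)
  exact ((hanti ⟨le_rfl, hqt⟩ ⟨hqt, le_rfl⟩ hqt).trans hqM).not_gt hlt

/-- Over a flow interval longer than the time needed to decay from `z ≥ y s` to `a`, the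
trajectory decays below `max a c`, where `c` is the threshold above which decay is guaranteed. -/
lemma leftLim_le_of_integral_le {φ y : ℝ → ℝ} (hφ : PosDef φ) {s e a b c z : ℝ} (hse : s < e)
    (hc : ContinuousOn y (Ico s e)) (hdiff : ∀ t ∈ Ioo s e, DifferentiableAt ℝ y t)
    (hd : ∀ t ∈ Ioo s e, c ≤ y t → deriv y t ≤ -φ (y t))
    (ha : 0 < a) (hb : Tendsto y (𝓝[<] e) (𝓝 b)) (hz : y s ≤ z)
    (hint : ∫ v in a..z, 1 / φ v ≤ e - s) : b ≤ max a c := by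
  by_contra! hlt
  set M := max a c
  have haM : a ≤ M := le_max_left a c
  have hcM : c ≤ M := le_max_right a c
  have hIco : ∀ᶠ t in 𝓝[<] e, t ∈ Ico s e := Ico_mem_nhdsLT hse
  have habove : ∀ t ∈ Ico s e, M < y t := by
    intro t ht
    by_contra! htM
    refine (le_of_tendsto hb ?_).not_gt hlt
    filter_upwards [Ico_mem_nhdsLT ht.2] with q hq
    refine le_of_deriv_nonpos_of_lt hc (fun p hp hMp => ?_) hdiff ht.1 hq.1 hq.2 htM
    have hpos := hφ.2.2 (y p) (ha.trans_le (haM.trans hMp.le))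
    linarith [hd p hp (hcM.trans hMp.le)]
  have hcont : ContinuousOn (fun v => 1 / φ v) (Ioi 0) :=
    continuousOn_const.div (hφ.1.mono Ioi_subset_Ici_self) fun v hv => (hφ.2.2 v hv).ne'
  have hii : ∀ p q : ℝ, 0 < p → 0 < q →
      IntervalIntegrable (fun v => 1 / φ v) MeasureTheory.volume p q := fun p q hp hq =>
    (hcont.mono fun v hv => (lt_min hp hq).trans_le hv.1).intervalIntegrable
  set G : ℝ → ℝ := fun w => ∫ v in a..w, 1 / φ v
  have hGd : ∀ w > 0, HasDerivAt G (1 / φ w) w := fun w hw =>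
    integral_hasDerivAt_right (hii a w ha hw)
      (hcont.stronglyMeasurableAtFilter isOpen_Ioi w hw) (hcont.continuousAt (Ioi_mem_nhds hw))
  have hGm : StrictMonoOn G (Ioi 0) := by
    refine strictMonoOn_of_deriv_pos (convex_Ioi 0)
      (fun w hw => (hGd w hw).continuousAt.continuousWithinAt) fun w hw => ?_
    rw [interior_Ioi] at hw
    rw [(hGd w hw).deriv]
    exact one_div_pos.2 (hφ.2.2 w hw)
  have hypos : ∀ t ∈ Ico s e, 0 < y t := fun t ht => ha.trans_le (haM.trans (habove t ht).le)
  have hder : ∀ t ∈ Ioo s e,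
      HasDerivAt (fun q => G (y q) + q) (1 / φ (y t) * deriv y t + 1) t := fun t ht =>
    ((hGd _ (hypos t (Ioo_subset_Ico_self ht))).comp t (hdiff t ht).hasDerivAt).add
      (hasDerivAt_id t)
  have hanti : AntitoneOn (fun q => G (y q) + q) (Ico s e) := by
    refine antitoneOn_of_deriv_nonpos (convex_Ico s e) ?_ ?_ ?_
    · refine ContinuousOn.add (fun t ht => ?_) continuousOn_id
      exact (hGd _ (hypos t ht)).continuousAt.comp_continuousWithinAt (hc t ht)
    · rw [interior_Ico]
      exact fun t ht => (hder t ht).differentiableAt.differentiableWithinAt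
    · rw [interior_Ico]
      intro t ht
      have ht' := Ioo_subset_Ico_self ht
      have hpos := hφ.2.2 _ (hypos t ht')
      have hle := hd t ht (hcM.trans (habove t ht').le)
      rw [(hder t ht).deriv, one_div_mul_eq_div]
      have : deriv y t / φ (y t) ≤ -1 := by
        rw [div_le_iff₀ hpos]
        linarith
      linarith
  have hs : s ∈ Ico s e := ⟨le_rfl, hse⟩
  have hb0 : 0 < b := ha.trans_le (haM.trans hlt.le)
  have hlim : G b + e ≤ G (y s) + s := by
    refine le_of_tendsto (((hGd b hb0).continuousAt.tendsto.comp hb).add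
      (tendsto_nhdsWithin_of_tendsto_nhds tendsto_id)) ?_
    filter_upwards [hIco] with t ht
    exact hanti hs ht ht.1
  have hGz : G (y s) ≤ G z :=
    hGm.monotoneOn (hypos s hs) ((hypos s hs).trans_le hz) hz
  have hGb : G a < G b := hGm ha hb0 (haM.trans_lt hlt)
  have hGa : G a = 0 := integral_same
  have hzint : G z ≤ e - s := hint
  linarith

/-! ### Bounds along a Lyapunov trajectory -/

lemma LyapTraj.bound {t0 θ u : ℝ} {T : ℕ → ℝ} {φ α χ A y : ℝ → ℝ} {ym : ℕ → ℝ}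
    (hφ : PosDef φ) (hα : PosDef α) (hχu : 0 ≤ χ u)
    (hFDT : ∀ a > (0 : ℝ), (∫ s in a..(α a), 1 / φ s) ≤ θ)
    (hA : ∀ r ≥ (0 : ℝ), r ≤ A r) (hαA : ∀ r, ∀ s ∈ Icc 0 r, α s ≤ A r)
    (hT : ImpulseSeq t0 T) (hdwell : ∀ i, θ ≤ T (i + 1) - T i)
    (hy : LyapTraj t0 T u (fun s => -φ s) α χ y ym) {t : ℝ} (ht : t0 ≤ t) :
    y t ≤ A (max (y t0) (χ u)) := by
  obtain ⟨hnn, hc0, hci, hlim, hdiff, hder, hjump⟩ := hy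
  obtain ⟨hTm, hT0, hTtop⟩ := hT
  have ht0T : ∀ i, t0 < T i := fun i => hT0.trans_le (hTm.monotone (Nat.zero_le i))
  have hφnn : ∀ v ≥ (0 : ℝ), 0 ≤ φ v := fun v hv => by
    rcases hv.eq_or_lt with rfl | hv
    · exact hφ.2.1.ge
    · exact (hφ.2.2 v hv).le
  have hoff0 : ∀ q ∈ Ioo t0 (T 0), ∀ i, q ≠ T i := fun q hq i =>
    (hq.2.trans_le (hTm.monotone (Nat.zero_le i))).ne
  have hoff : ∀ k, ∀ q ∈ Ioo (T k) (T (k + 1)), ∀ i, q ≠ T i := by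
    rintro k q hq i rfl
    have h1 := hTm.lt_iff_lt.1 hq.1
    have h2 := hTm.lt_iff_lt.1 hq.2
    omega
  have hge : ∀ k, ∀ q ∈ Ioo (T k) (T (k + 1)), t0 ≤ q := fun k q hq =>
    ((ht0T k).trans hq.1).le
  set M := max (y t0) (χ u)
  have hM0 : 0 ≤ M := hχu.trans (le_max_right _ _)
  have hflow : ∀ {q N : ℝ}, t0 ≤ q → (∀ i, q ≠ T i) → χ u ≤ N → N < y q → deriv y q ≤ 0 :=
    fun {q N} hq hqT hN hlt => by
      have := hder q hq hqT (hN.trans hlt.le)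
      linarith [hφnn (y q) (hnn q hq)]
  have hfirst : ∀ q ∈ Ico t0 (T 0), y q ≤ M := fun q hq =>
    le_of_deriv_nonpos_of_lt hc0
      (fun p hp => hflow hp.1.le (hoff0 p hp) (le_max_right _ _))
      (fun p hp => hdiff p hp.1.le (hoff0 p hp)) le_rfl hq.1 hq.2 (le_max_left _ _)
  have hlater : ∀ k, ∀ N ≥ χ u, y (T k) ≤ N → ∀ q ∈ Ico (T k) (T (k + 1)), y q ≤ N :=
    fun k N hN hk q hq =>
      le_of_deriv_nonpos_of_lt (hci k)
        (fun p hp => hflow (hge k p hp) (hoff k p hp) hN)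
        (fun p hp => hdiff p (hge k p hp) (hoff k p hp)) le_rfl hq.1 hq.2 hk
  have hym0 : ∀ k, 0 ≤ ym k := fun k => by
    refine ge_of_tendsto (hlim k) ?_
    filter_upwards [Ico_mem_nhdsLT (ht0T k)] with q hq
    exact hnn q hq.1
  have hymM : ∀ k, ym k ≤ M := by
    intro k
    induction k with
    | zero =>
      refine le_of_tendsto (hlim 0) ?_
      filter_upwards [Ico_mem_nhdsLT hT0] with q hq
      exact hfirst q hq
    | succ k ih =>
      have hlt : T k < T (k + 1) := hTm k.lt_succ_self
      by_cases hk : y (T k) ≤ χ u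
      · refine le_of_tendsto (hlim (k + 1)) ?_
        filter_upwards [Ico_mem_nhdsLT hlt] with q hq
        exact (hlater k _ le_rfl hk q hq).trans (le_max_right _ _)
      · have hkα : y (T k) ≤ α (ym k) := (le_max_iff.1 (hjump k)).resolve_right hk
        have hpos : 0 < ym k := by
          refine (hym0 k).lt_of_ne fun h => hk ?_
          rw [← h, hα.2.1] at hkα
          exact hkα.trans hχu
        exact (leftLim_le_of_integral_le hφ hlt (hci k)
          (fun p hp => hdiff p (hge k p hp) (hoff k p hp))
          (fun p hp => hder p (hge k p hp) (hoff k p hp)) hpos (hlim (k + 1)) hkα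
          ((hFDT _ hpos).trans (hdwell k))).trans (max_le ih (le_max_right _ _))
  have hMA : M ≤ A M := hA M hM0
  rcases lt_or_ge t (T 0) with htT | htT
  · exact (hfirst t ⟨ht, htT⟩).trans hMA
  · obtain ⟨k, hk⟩ : ∃ k, t ∈ Ico (T k) (T (k + 1)) := by
      have hex : ∃ n, t < T n := (hTtop.eventually_gt_atTop t).exists
      classical
      obtain ⟨m, hm⟩ : ∃ m, Nat.find hex = m + 1 :=
        Nat.exists_eq_succ_of_ne_zero fun h => (h ▸ Nat.find_spec hex).not_ge htT
      exact ⟨m, not_lt.1 (Nat.find_min hex (by omega)), hm ▸ Nat.find_spec hex⟩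
    exact hlater k _ ((le_max_right _ _).trans hMA)
      ((hjump k).trans (max_le (hαA M _ ⟨hym0 k, hymM k⟩) ((le_max_right _ _).trans hMA))) t hk

/-- uniform global stability over the fixed dwell-time class `S_θ`
under the FDT condition with `δ = 0`: `∫_a^{α(a)} ds/φ(s) ≤ θ`; `ξ` and `γ` are
independent of the impulse time sequence. -/
theorem stmt_6 {X : Type*} [NormedAddCommGroup X]
    (t0 : ℝ) (ψ₁ ψ₂ : ℝ → ℝ) (hψ₁ : ClassKinf ψ₁) (hψ₂ : ClassKinf ψ₂)
    (V : X → ℝ) (hVc : Continuous V) (hVnn : ∀ x, 0 ≤ V x)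
    (hVlow : ∀ x : X, ψ₁ ‖x‖ ≤ V x) (hVup : ∀ x : X, V x ≤ ψ₂ ‖x‖)
    (φ α : ℝ → ℝ) (hφ : PosDef φ) (hα : PosDef α)
    (χ : ℝ → ℝ) (hχ : ClassKinf χ)
    (θ : ℝ) (hθ : 0 < θ)
    (hFDT : ∀ a > (0:ℝ), (∫ s in a..(α a), 1 / φ s) ≤ θ) :
    ∃ ξ γ : ℝ → ℝ, ClassKinf ξ ∧ ClassK γ ∧
      ∀ T : ℕ → ℝ, ImpulseSeq t0 T → (∀ i, θ ≤ T (i+1) - T i) →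
        ∀ u ≥ (0:ℝ), ∀ x : ℝ → X, ∀ ym : ℕ → ℝ,
          LyapTraj t0 T u (fun s => -φ s) α χ (fun t => V (x t)) ym →
          ∀ t ≥ t0, ‖x t‖ ≤ ξ ‖x t0‖ + γ u := by
  obtain ⟨A, hAK, hA, hαA⟩ := hα.exists_classKinf_majorant
  obtain ⟨g, hg, hgψ⟩ := hψ₁.exists_leftInverse
  have hgA := hg.comp hAK
  refine ⟨(g ∘ A) ∘ ψ₂, (g ∘ A) ∘ χ, hgA.comp hψ₂, hgA.1.comp hχ.1, ?_⟩
  intro T hT hdwell u hu x ym hy t ht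
  have hχu := hχ.1.nonneg hu
  have hψx := hψ₂.1.nonneg (norm_nonneg (x t0))
  have hV : V (x t) ≤ A (max (V (x t0)) (χ u)) :=
    hy.bound hφ hα hχu hFDT hA hαA hT hdwell ht
  have hψV : ψ₁ ‖x t‖ ≤ A (max (ψ₂ ‖x t0‖) (χ u)) :=
    (hVlow _).trans <| hV.trans <| hAK.1.2.1.monotoneOn (hχu.trans (le_max_right _ _))
      (hχu.trans (le_max_right _ _)) (max_le_max_right _ (hVup _))
  have hbound : ‖x t‖ ≤ (g ∘ A) (max (ψ₂ ‖x t0‖) (χ u)) := by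
    have h0 := hψ₁.1.nonneg (norm_nonneg (x t))
    have := hg.1.2.1.monotoneOn h0 (h0.trans hψV) hψV
    rwa [hgψ _ (norm_nonneg _)] at this
  have h1 := hgA.1.nonneg hψx
  have h2 := hgA.1.nonneg hχu
  rcases max_cases (ψ₂ ‖x t0‖) (χ u) with ⟨h, _⟩ | ⟨h, _⟩ <;> rw [h] at hbound
  · exact hbound.trans (le_add_of_nonneg_right h2)
  · exact hbound.trans (le_add_of_nonneg_left h1)
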